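/- Every symmetric encryption scheme satisfying reusable t→t' uncloneable security (for any t' > t ≥ 1) also satisfies reusable IND-CPA security; consequently, the existence of reusable uncloneable encryption implies the existence of reusable IND-CPA symmetric key encryption. -/

import Mathlib

set_option linter.unusedVariables false

/- ================================================================
   A concrete model of quantum computation on qubit registers.

   States of an `n`-qubit register are density matrices indexed by
   bit strings of length `n`.  (Non-uniform) quantum polynomial time
   is modelled by families of quantum circuits built from arbitrary
   two-qubit channels, wire permutations, ancilla creation and
   discarding, with polynomially many gates.
   ================================================================ -/

open scoped ComplexOrder Matrix

noncomputable section

/-- Bit strings of length `n`. -/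
abbrev BString (n : ℕ) := Fin n → Bool

/-- (Not necessarily normalized) operators on an `n`-qubit register. -/
abbrev QOp (n : ℕ) := Matrix (BString n) (BString n) ℂ

/-- The empty bit string. -/
def bnil : BString 0 := fun i => i.elim0

/-- Splitting a register into two consecutive parts. -/
def bsplit (a b : ℕ) : BString (a + b) ≃ BString a × BString b :=
  (Equiv.arrowCongr finSumFinEquiv.symm (Equiv.refl Bool)).trans
    (Equiv.sumArrowEquivProdArrow _ _ _)

/-- Concatenation of bit strings. -/
def bappend {a b : ℕ} (s : BString a) (t : BString b) : BString (a + b) :=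
  (bsplit a b).symm (s, t)

/-- Recasting the length of a bit string. -/
def bcast {a b : ℕ} (h : a = b) : BString a ≃ BString b :=
  Equiv.arrowCongr (finCongr h) (Equiv.refl Bool)

/-- The all-zero bit string. -/
def bzero (n : ℕ) : BString n := fun _ => false

/-- Viewing a bit string of length `a * w` as `a` blocks of length `w`. -/
def bflat {a w : ℕ} (f : Fin a → BString w) : BString (a * w) :=
  fun j => f (finProdFinEquiv.symm j).1 (finProdFinEquiv.symm j).2

/-- Recasting the width of a register. -/
def castOp {a b : ℕ} (h : a = b) (M : QOp a) : QOp b :=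
  Matrix.reindex (bcast h) (bcast h) M

/-- Tensor product of operators on consecutive registers. -/
def tensorOp {a b : ℕ} (M : QOp a) (N : QOp b) : QOp (a + b) :=
  Matrix.reindex (bsplit a b).symm (bsplit a b).symm
    (Matrix.of fun p q => M p.1 q.1 * N p.2 q.2)

/-- Extension `Φ ⊗ id` of a linear map to `m` further wires on the right. -/
def extendR {a b : ℕ} (Φ : QOp a → QOp b) (m : ℕ) (M : QOp (a + m)) : QOp (b + m) :=
  Matrix.reindex (bsplit b m).symm (bsplit b m).symm
    (Matrix.of fun p q =>
      Φ (Matrix.of fun x y => Matrix.reindex (bsplit a m) (bsplit a m) M (x, p.2) (y, q.2))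
        p.1 q.1)

/-- Extension `id ⊗ Φ` of a linear map to `m` further wires on the left. -/
def extendL {a b : ℕ} (m : ℕ) (Φ : QOp a → QOp b) (M : QOp (m + a)) : QOp (m + b) :=
  Matrix.reindex (bsplit m b).symm (bsplit m b).symm
    (Matrix.of fun p q =>
      Φ (Matrix.of fun x y => Matrix.reindex (bsplit m a) (bsplit m a) M (p.1, x) (q.1, y))
        p.2 q.2)

/-- Tensor product `Φ ⊗ Ψ` of two (linear) maps. -/
def tensorMap {a b c d : ℕ} (Φ : QOp a → QOp b) (Ψ : QOp c → QOp d)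
    (M : QOp (a + c)) : QOp (b + d) :=
  extendL b Ψ (extendR Φ c M)

/-- The channel permuting the wires of a register according to `π`. -/
def permOp {n : ℕ} (π : Equiv.Perm (Fin n)) (M : QOp n) : QOp n :=
  Matrix.reindex (Equiv.arrowCongr π (Equiv.refl Bool)) (Equiv.arrowCongr π (Equiv.refl Bool)) M

/-- The classical basis state `|s⟩⟨s|`. -/
def basisOp {n : ℕ} (s : BString n) : QOp n :=
  Matrix.of fun x y => if x = s ∧ y = s then 1 else 0

/-- The (trivial) state of an empty register. -/
def unitOp : QOp 0 := Matrix.of fun _ _ => 1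

/-- The maximally mixed state on `n` qubits. -/
def maxMixed (n : ℕ) : QOp n :=
  Matrix.of fun x y => if x = y then ((2 ^ n : ℂ))⁻¹ else 0

/-- Appending a fresh ancilla qubit in state `|0⟩`. -/
def addAncilla {n : ℕ} (M : QOp n) : QOp (n + 1) :=
  tensorOp M (basisOp (bzero 1))

/-- Tracing out the last qubit of a register. -/
def traceLast {n : ℕ} (M : QOp (n + 1)) : QOp n :=
  Matrix.of fun x y => ∑ u : BString 1,
    Matrix.reindex (bsplit n 1) (bsplit n 1) M (x, u) (y, u)

/-- The channel that measures its (classical) input register and prepares `f s`. -/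
def clChannel {a b : ℕ} (f : BString a → QOp b) (M : QOp a) : QOp b :=
  ∑ s : BString a, M s s • f s

/-- The channel that measures its first register, obtaining a classical string `s`, and
applies the channel `f s` to the rest. -/
def clControlled {a b c : ℕ} (f : BString a → QOp b → QOp c) (M : QOp (a + b)) : QOp c :=
  ∑ s : BString a,
    f s (Matrix.of fun x y => Matrix.reindex (bsplit a b) (bsplit a b) M (s, x) (s, y))

/-- The (subnormalized) state of the second register after the first register is
measured with outcome `s`. -/
def clSlice {a c : ℕ} (M : QOp (a + c)) (s : BString a) : QOp c :=
  Matrix.of fun x y => Matrix.reindex (bsplit a c) (bsplit a c) M (s, x) (s, y)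

/-- The classical state corresponding to a probability distribution on key pairs. -/
def pmfOp {a b : ℕ} (p : PMF (BString a × BString b)) : QOp (a + b) :=
  Matrix.of fun x y => if x = y then ((p (bsplit a b x)).toReal : ℂ) else 0

/-- `t`-fold tensor power of a state. -/
def itTensor {n : ℕ} : (t : ℕ) → QOp n → QOp (t * n)
  | 0, _ => castOp (zero_mul n).symm unitOp
  | (t + 1), ρ => castOp (by ring) (tensorOp ρ (itTensor t ρ))

/-- Tensor product of a family of `t` maps. -/
def itTensorMap {a b : ℕ} : (t : ℕ) → (Fin t → (QOp a → QOp b)) → QOp (t * a) → QOp (t * b)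
  | 0, _ => fun M => castOp (by simp) M
  | (t + 1), Φ => fun M =>
      castOp (by ring)
        (tensorMap (Φ 0) (itTensorMap t (fun i => Φ i.succ)) (castOp (by ring) M))

/-- The probability of observing outcome `s` when measuring all wires of `ρ`
in the computational basis. -/
def diagProb {n : ℕ} (ρ : QOp n) (s : BString n) : ℝ := (ρ s s).re

/-- The pure state `|v⟩⟨v|`. -/
def vecState {n : ℕ} (v : BString n → ℂ) : QOp n :=
  Matrix.of fun x y => v x * star (v y)

/-- Conjugation by a matrix (the channel of a unitary). -/
def conjOp {n : ℕ} (V : Matrix (BString n) (BString n) ℂ) (ρ : QOp n) : QOp n :=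
  V * ρ * Vᴴ

/-- Positive maps. -/
def IsPosMap {a b : ℕ} (Φ : QOp a → QOp b) : Prop :=
  ∀ ρ, ρ.PosSemidef → (Φ ρ).PosSemidef

/-- Quantum channels: linear, completely positive, trace-preserving maps. -/
structure IsChannel {a b : ℕ} (Φ : QOp a → QOp b) : Prop where
  linear : IsLinearMap ℂ Φ
  cp : ∀ m, IsPosMap (extendR Φ m)
  tp : ∀ ρ, (Φ ρ).trace = ρ.trace

/-- Density matrices. -/
def IsDensity {n : ℕ} (ρ : QOp n) : Prop := ρ.PosSemidef ∧ ρ.trace = 1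

/-- `Gates Φ k`: `Φ` is implemented by a quantum circuit with at most `k` elementary
operations (arbitrary two-qubit channels, wire permutations, `|0⟩`-ancilla creation,
and discarding of wires). -/
inductive Gates : ∀ {a b : ℕ}, (QOp a → QOp b) → ℕ → Prop
  | id (a : ℕ) : Gates (id : QOp a → QOp a) 0
  | comp {a b c : ℕ} {Φ : QOp a → QOp b} {Ψ : QOp b → QOp c} {k l : ℕ} :
      Gates Φ k → Gates Ψ l → Gates (Ψ ∘ Φ) (k + l)
  | perm {n : ℕ} (π : Equiv.Perm (Fin n)) : Gates (permOp π) 1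
  | gate {m : ℕ} (Φ : QOp 2 → QOp 2) : IsChannel Φ → Gates (extendR Φ m) 1
  | ancilla (n : ℕ) : Gates (addAncilla (n := n)) 1
  | discard (n : ℕ) : Gates (traceLast (n := n)) 1

/-- A family of maps indexed by the security parameter is (non-uniform) quantum
polynomial time if it is implemented by circuits of polynomially many gates. -/
def PolyGates (a b : ℕ → ℕ) (Φ : ∀ l, QOp (a l) → QOp (b l)) : Prop :=
  ∃ p : Polynomial ℕ, ∀ l, ∃ k ≤ p.eval l, Gates (Φ l) k

/-- Oracle circuits: `OGates oi oo F k` means that the functional `F`, mapping an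
oracle channel (from `oi` wires to `oo` wires) to a map, is implemented by a circuit
with at most `k` elementary operations and oracle calls. -/
inductive OGates (oi oo : ℕ) : ∀ {a b : ℕ}, ((QOp oi → QOp oo) → QOp a → QOp b) → ℕ → Prop
  | plain {a b : ℕ} {Φ : QOp a → QOp b} {k : ℕ} :
      Gates Φ k → OGates oi oo (fun _ => Φ) k
  | call (m : ℕ) : OGates oi oo (fun O => extendR O m) 1
  | comp {a b c : ℕ} {F : (QOp oi → QOp oo) → QOp a → QOp b}
      {G : (QOp oi → QOp oo) → QOp b → QOp c} {k l : ℕ} :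
      OGates oi oo F k → OGates oi oo G l → OGates oi oo (fun O => (G O) ∘ (F O)) (k + l)

/-- Polynomial-time oracle algorithms. -/
def PolyOGates (oi oo a b : ℕ → ℕ)
    (F : ∀ l, (QOp (oi l) → QOp (oo l)) → QOp (a l) → QOp (b l)) : Prop :=
  ∃ p : Polynomial ℕ, ∀ l, ∃ k ≤ p.eval l, OGates (oi l) (oo l) (F l) k

/-- Negligible functions. -/
def Negligible (f : ℕ → ℝ) : Prop :=
  ∀ c : ℕ, ∃ N, ∀ n ≥ N, |f n| ≤ 1 / (n : ℝ) ^ c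

end

noncomputable section

/-- Tracing out the second of two consecutive registers. -/
def ptraceR {a b : ℕ} (M : QOp (a + b)) : QOp a :=
  Matrix.of fun x y => ∑ u : BString b,
    Matrix.reindex (bsplit a b) (bsplit a b) M (x, u) (y, u)

end
/- ================================================================
   Symmetric key encryption schemes with quantum ciphertexts,
   and the associated security games.
   ================================================================ -/

noncomputable section

/-- A symmetric key encryption scheme (with classical keys and messages and a quantum
ciphertext), given by polynomial-time algorithms `gen`, `enc`, `dec`. -/
structure EncScheme where
  /-- encryption key length -/
  ℓek : ℕ → ℕ
  /-- decryption key length -/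
  ℓdk : ℕ → ℕ
  /-- message length -/
  ℓm : ℕ → ℕ
  /-- ciphertext register width -/
  ℓct : ℕ → ℕ
  /-- key generation -/
  gen : ∀ l, PMF (BString (ℓek l) × BString (ℓdk l))
  /-- encryption -/
  enc : ∀ l, BString (ℓek l) → BString (ℓm l) → QOp (ℓct l)
  /-- decryption -/
  dec : ∀ l, BString (ℓdk l) → QOp (ℓct l) → QOp (ℓm l)
  enc_density : ∀ l k m, IsDensity (enc l k m)
  dec_channel : ∀ l k, IsChannel (dec l k)
  gen_poly : PolyGates (fun _ => 0) (fun l => ℓek l + ℓdk l)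
    (fun l M => M bnil bnil • pmfOp (gen l))
  enc_poly : PolyGates (fun l => ℓek l + ℓm l) ℓct
    (fun l => clControlled (fun k => clChannel (enc l k)))
  dec_poly : PolyGates (fun l => ℓdk l + ℓct l) ℓm (fun l => clControlled (dec l))

/-- (Perfect) correctness of an encryption scheme. -/
def Correct (S : EncScheme) : Prop :=
  ∀ l (m : BString (S.ℓm l)), ∀ kd ∈ (S.gen l).support,
    diagProb (S.dec l kd.2 (S.enc l kd.1 m)) m = 1

/-- Correctness up to a negligible error. -/
def AlmostCorrect (S : EncScheme) : Prop :=
  ∃ ε, Negligible ε ∧ ∀ l (m : BString (S.ℓm l)),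
    1 - ε l ≤ ∑ kd : BString (S.ℓek l) × BString (S.ℓdk l),
      ((S.gen l) kd).toReal * diagProb (S.dec l kd.2 (S.enc l kd.1 m)) m

/-- A scheme is of normal form if the encryption and decryption keys coincide. -/
structure NormalForm (S : EncScheme) : Prop where
  len : ∀ l, S.ℓek l = S.ℓdk l
  eq : ∀ l, ∀ kd ∈ (S.gen l).support, kd.2 = bcast (len l) kd.1

/-- The (classical-query) encryption oracle. -/
def encOracle (S : EncScheme) (l : ℕ) (ek : BString (S.ℓek l)) :
    QOp (S.ℓm l) → QOp (S.ℓct l) :=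
  clChannel (S.enc l ek)

/-- An adversary for the IND-CPA game: a first stage producing the two challenge
messages (measured from the first two registers of its output) and a residual state,
and a second stage receiving the challenge ciphertext and the residual state and
producing a guess.  Both stages have oracle access to encryption. -/
structure INDAdv (S : EncScheme) where
  w : ℕ → ℕ
  C1 : ∀ l, (QOp (S.ℓm l) → QOp (S.ℓct l)) → QOp 0 → QOp ((S.ℓm l + S.ℓm l) + w l)
  C2 : ∀ l, (QOp (S.ℓm l) → QOp (S.ℓct l)) → QOp (S.ℓct l + w l) → QOp 1
  C1_poly : PolyOGates S.ℓm S.ℓct (fun _ => 0) (fun l => (S.ℓm l + S.ℓm l) + w l) C1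
  C2_poly : PolyOGates S.ℓm S.ℓct (fun l => S.ℓct l + w l) (fun _ => 1) C2

/-- The winning probability in the IND-CPA game. -/
def indWin (S : EncScheme) (A : INDAdv S) (l : ℕ) : ℝ :=
  ∑ kd : BString (S.ℓek l) × BString (S.ℓdk l),
    ((S.gen l) kd).toReal *
      ((1 : ℝ) / 2 * ∑ b : Bool, ∑ m01 : BString (S.ℓm l + S.ℓm l),
        (let ρ1 := A.C1 l (encOracle S l kd.1) unitOp
         let st := clSlice ρ1 m01
         let mb := if b then (bsplit (S.ℓm l) (S.ℓm l) m01).2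
                   else (bsplit (S.ℓm l) (S.ℓm l) m01).1
         diagProb (A.C2 l (encOracle S l kd.1) (tensorOp (S.enc l kd.1 mb) st))
           (fun _ => b)))

/-- Reusable IND-CPA security. -/
def IndCpaSecure (S : EncScheme) : Prop :=
  ∀ A : INDAdv S, ∃ ε, Negligible ε ∧ ∀ l, indWin S A l ≤ 1 / 2 + ε l

/-- An adversary for the pseudorandomness game. -/
structure PRAdv (S : EncScheme) where
  w : ℕ → ℕ
  C1 : ∀ l, (QOp (S.ℓm l) → QOp (S.ℓct l)) → QOp 0 → QOp (S.ℓm l + w l)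
  C2 : ∀ l, (QOp (S.ℓm l) → QOp (S.ℓct l)) → QOp (S.ℓct l + w l) → QOp 1
  C1_poly : PolyOGates S.ℓm S.ℓct (fun _ => 0) (fun l => S.ℓm l + w l) C1
  C2_poly : PolyOGates S.ℓm S.ℓct (fun l => S.ℓct l + w l) (fun _ => 1) C2

/-- The winning probability in the pseudorandomness game: the adversary must decide
whether it received an encryption of its chosen message or a maximally mixed state. -/
def prWin (S : EncScheme) (A : PRAdv S) (l : ℕ) : ℝ :=
  ∑ kd : BString (S.ℓek l) × BString (S.ℓdk l),
    ((S.gen l) kd).toReal *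
      ((1 : ℝ) / 2 * ∑ b : Bool, ∑ m : BString (S.ℓm l),
        (let st := clSlice (A.C1 l (encOracle S l kd.1) unitOp) m
         let ρ := if b then maxMixed (S.ℓct l) else S.enc l kd.1 m
         diagProb (A.C2 l (encOracle S l kd.1) (tensorOp ρ st)) (fun _ => b)))

/-- A scheme has pseudorandom ciphertexts if encryptions are computationally
indistinguishable from the maximally mixed state, even given the encryption oracle. -/
def Pseudorandom (S : EncScheme) : Prop :=
  ∀ A : PRAdv S, ∃ ε, Negligible ε ∧ ∀ l, prWin S A l ≤ 1 / 2 + ε l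

/-- An adversary for the `t → t'` cloning game: an oracle stage `C1` producing the
challenge messages and a residual state, an oracle stage `C2` receiving `t` challenge
ciphertexts and splitting the state into `t'` registers of width `wA`, and `t'`
final adversaries `A` receiving the decryption key and one register each. -/
structure CloneAdv (S : EncScheme) (t t' : ℕ → ℕ) where
  w : ℕ → ℕ
  wA : ℕ → ℕ
  C1 : ∀ l, (QOp (S.ℓm l) → QOp (S.ℓct l)) → QOp 0 → QOp ((S.ℓm l + S.ℓm l) + w l)
  C2 : ∀ l, (QOp (S.ℓm l) → QOp (S.ℓct l)) →
    QOp (t l * S.ℓct l + w l) → QOp (t' l * wA l)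
  A : ∀ l, Fin (t' l) → BString (S.ℓdk l) → QOp (wA l) → QOp 1
  C1_poly : PolyOGates S.ℓm S.ℓct (fun _ => 0) (fun l => (S.ℓm l + S.ℓm l) + w l) C1
  C2_poly : PolyOGates S.ℓm S.ℓct (fun l => t l * S.ℓct l + w l) (fun l => t' l * wA l) C2
  A_poly : ∃ p : Polynomial ℕ, ∀ l (i : Fin (t' l)), ∃ k ≤ p.eval l,
    Gates (clControlled (A l i)) k

/-- The winning probability in the `t → t'` cloning game
(`CLONE` in the paper): all `t'` parties must guess the challenge bit. -/
def cloneWin (S : EncScheme) (t t' : ℕ → ℕ) (A : CloneAdv S t t') (l : ℕ) : ℝ :=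
  ∑ kd : BString (S.ℓek l) × BString (S.ℓdk l),
    ((S.gen l) kd).toReal *
      ((1 : ℝ) / 2 * ∑ b : Bool, ∑ m01 : BString (S.ℓm l + S.ℓm l),
        (let ρ1 := A.C1 l (encOracle S l kd.1) unitOp
         let st := clSlice ρ1 m01
         let mb := if b then (bsplit (S.ℓm l) (S.ℓm l) m01).2
                   else (bsplit (S.ℓm l) (S.ℓm l) m01).1
         let τ := A.C2 l (encOracle S l kd.1)
           (tensorOp (itTensor (t l) (S.enc l kd.1 mb)) st)
         let out := itTensorMap (t' l) (fun i => A.A l i kd.2) τ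
         diagProb out (fun _ => b)))

/-- Reusable `t → t'` uncloneable (indistinguishability) security. -/
def ReusableCloneSecure (S : EncScheme) (t t' : ℕ → ℕ) : Prop :=
  ∀ A : CloneAdv S t t', ∃ ε, Negligible ε ∧ ∀ l, cloneWin S t t' A l ≤ 1 / 2 + ε l

/-- One-time `t → t'` uncloneable security: as above, but only against adversaries
making no oracle queries (i.e. whose stages do not depend on the oracle). -/
def OTCloneSecure (S : EncScheme) (t t' : ℕ → ℕ) : Prop :=
  ∀ A : CloneAdv S t t',
    (∀ l O O', A.C1 l O = A.C1 l O') → (∀ l O O', A.C2 l O = A.C2 l O') →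
    ∃ ε, Negligible ε ∧ ∀ l, cloneWin S t t' A l ≤ 1 / 2 + ε l

/-- A `t → t'` uncloneable bit: a one-time `t → t'` secure scheme for one-bit
messages. -/
def UncloneableBit (S : EncScheme) (t t' : ℕ → ℕ) : Prop :=
  (∀ l, S.ℓm l = 1) ∧ Correct S ∧ OTCloneSecure S t t'

end


section Helpers

open Finset

theorem bsplit_apply' (a b : ℕ) (x : BString (a + b)) :
    bsplit a b x = (fun i => x (Fin.castAdd b i), fun j => x (Fin.natAdd a j)) := by
  rfl

theorem bsplit_symm_castAdd (a b : ℕ) (p : BString a × BString b) (i : Fin a) :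
    (bsplit a b).symm p (Fin.castAdd b i) = p.1 i := by
  have := (bsplit a b).apply_symm_apply p
  rw [bsplit_apply'] at this
  exact congrFun (congrArg Prod.fst this) i

theorem bsplit_symm_natAdd (a b : ℕ) (p : BString a × BString b) (i : Fin b) :
    (bsplit a b).symm p (Fin.natAdd a i) = p.2 i := by
  have := (bsplit a b).apply_symm_apply p
  rw [bsplit_apply'] at this
  exact congrFun (congrArg Prod.snd this) i

theorem tensorOp_apply {a b : ℕ} (M : QOp a) (N : QOp b) (x y : BString (a + b)) :
    tensorOp M N x y = M (fun i => x (Fin.castAdd b i)) (fun i => y (Fin.castAdd b i)) *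
      N (fun i => x (Fin.natAdd a i)) (fun i => y (Fin.natAdd a i)) := rfl

theorem castOp_apply {a b : ℕ} (h : a = b) (M : QOp a) (x y : BString b) :
    castOp h M x y = M (fun i => x (Fin.cast h i)) (fun i => y (Fin.cast h i)) := rfl

theorem castOp_rfl {a : ℕ} (h : a = a) (M : QOp a) : castOp h M = M := rfl

theorem permOp_apply {n : ℕ} (e : Equiv.Perm (Fin n)) (M : QOp n) (x y : BString n) :
    permOp e M x y = M (fun i => x (e i)) (fun i => y (e i)) := rfl

/-- Relabelling the wires along an equivalence. -/
def rewireOp {a b : ℕ} (e : Fin a ≃ Fin b) (M : QOp a) : QOp b :=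
  Matrix.of fun x y => M (fun i => x (e i)) (fun i => y (e i))

theorem gates_rewire {a b : ℕ} (e : Fin a ≃ Fin b) : Gates (rewireOp e) 1 := by
  have h : a = b := by simpa using Fintype.card_congr e
  subst h
  exact Gates.perm e

theorem gates_ptraceR (a c : ℕ) : Gates (ptraceR (a := a) (b := c)) c := by
  induction c with
  | zero =>
    have : (ptraceR (a := a) (b := 0)) = id := by
      funext M
      ext x y
      simp only [ptraceR, Matrix.of_apply, Fintype.sum_unique, id]
      have h : ∀ (z : BString a) (u : BString 0), (bsplit a 0).symm (z, u) = z := by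
        intro z u
        funext i
        exact bsplit_symm_castAdd a 0 (z, u) i
      simp only [Matrix.reindex_apply, Matrix.submatrix_apply]
      exact congrArg₂ M (h x _) (h y _)
    rw [this]
    exact Gates.id a
  | succ c ih =>
    have : (ptraceR (a := a) (b := c + 1)) = ptraceR (a := a) (b := c) ∘ traceLast := by
      funext M
      ext x y
      simp only [ptraceR, traceLast, Matrix.of_apply, Function.comp, Matrix.reindex_apply,
        Matrix.submatrix_apply]
      rw [← (bsplit c 1).symm.sum_comp, Fintype.sum_prod_type]
      have h : ∀ (z : BString a) (u : BString c) (v : BString 1),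
          (bsplit a (c + 1)).symm (z, (bsplit c 1).symm (u, v))
            = (bsplit (a + c) 1).symm ((bsplit a c).symm (z, u), v) := by
        intro z u v
        funext i
        induction i using Fin.addCases with
        | left i =>
          rw [bsplit_symm_castAdd]
          have : (Fin.castAdd (c + 1) i) = Fin.castAdd 1 (Fin.castAdd c i) := by ext; simp
          rw [this]
          erw [bsplit_symm_castAdd]
          simp [bsplit_symm_castAdd]
        | right i =>
          rw [bsplit_symm_natAdd]
          induction i using Fin.addCases with
          | left i =>
            have : (Fin.natAdd a (Fin.castAdd 1 i)) = Fin.castAdd 1 (Fin.natAdd a i) := by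
              ext; simp
            rw [this]
            erw [bsplit_symm_castAdd (a + c) 1]
            simp [bsplit_symm_castAdd, bsplit_symm_natAdd]
          | right i =>
            have : (Fin.natAdd a (Fin.natAdd c i)) = Fin.natAdd (a + c) i := by
              ext; simp
            rw [this]
            erw [bsplit_symm_natAdd (a + c) 1]
            simp [bsplit_symm_natAdd]
      refine Finset.sum_congr rfl fun u _ => Finset.sum_congr rfl fun v _ => ?_
      exact congrArg₂ M (h x u v) (h y u v)
    rw [this]
    have hg := Gates.comp (Gates.discard (a + c)) ih
    rw [add_comm 1 c] at hg
    exact hg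

/-- Discarding the wires which `e` sends to the right. -/
def margOp {a b c : ℕ} (e : Fin a ≃ Fin b ⊕ Fin c) (M : QOp a) : QOp b :=
  Matrix.of fun x y => ∑ u : BString c, M (fun i => Sum.elim x u (e i)) (fun i => Sum.elim y u (e i))

theorem gates_marg {a b c : ℕ} (e : Fin a ≃ Fin b ⊕ Fin c) : Gates (margOp e) (1 + c) := by
  have : margOp e = ptraceR ∘ rewireOp (e.trans finSumFinEquiv) := by
    funext M
    ext x y
    simp only [margOp, ptraceR, rewireOp, Matrix.of_apply, Function.comp, Matrix.reindex_apply,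
      Matrix.submatrix_apply]
    have h : ∀ (z : BString b) (u : BString c) (s : Fin b ⊕ Fin c),
        (bsplit b c).symm (z, u) (finSumFinEquiv s) = Sum.elim z u s := by
      rintro z u (s | s)
      · simp [bsplit_symm_castAdd]
      · simp [bsplit_symm_natAdd]
    simp only [Equiv.trans_apply, h]
  rw [this]
  exact Gates.comp (gates_rewire _) (gates_ptraceR _ _)

theorem trace_tensorOp {a b : ℕ} (M : QOp a) (N : QOp b) :
    (tensorOp M N).trace = M.trace * N.trace := by
  simp only [Matrix.trace, Matrix.diag]
  rw [← (bsplit a b).symm.sum_comp, Fintype.sum_prod_type, Finset.sum_mul_sum]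
  simp [tensorOp_apply, bsplit_symm_castAdd, bsplit_symm_natAdd]

theorem trace_castOp {a b : ℕ} (h : a = b) (M : QOp a) : (castOp h M).trace = M.trace := by
  subst h; rfl

theorem trace_itTensor {n : ℕ} (t : ℕ) (ρ : QOp n) (h : ρ.trace = 1) :
    (itTensor t ρ).trace = 1 := by
  induction t with
  | zero =>
    rw [itTensor, trace_castOp]
    simp [Matrix.trace, unitOp]
  | succ t ih => rw [itTensor, trace_castOp, trace_tensorOp, h, ih, one_mul]

theorem exists_discard (t n w : ℕ) (ht : 1 ≤ t) :
    ∃ D : QOp (t * n + w) → QOp (n + w), Gates D (1 + (t - 1) * n) ∧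
      ∀ (ρ : QOp n) (st : QOp w), ρ.trace = 1 →
        D (tensorOp (itTensor t ρ) st) = tensorOp ρ st := by
  obtain ⟨s, rfl⟩ : ∃ s, t = s + 1 := ⟨t - 1, by omega⟩
  have hc : (s + 1) * n = n + s * n := by ring
  let e : Fin ((s + 1) * n + w) ≃ Fin (n + w) ⊕ Fin (s * n) :=
    (finSumFinEquiv.symm.trans (Equiv.sumCongr ((finCongr hc).trans finSumFinEquiv.symm)
      (Equiv.refl _))).trans (((Equiv.sumAssoc _ _ _).trans
        ((Equiv.sumCongr (Equiv.refl _) (Equiv.sumComm _ _)).trans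
          (Equiv.sumAssoc _ _ _).symm)).trans
        (Equiv.sumCongr finSumFinEquiv (Equiv.refl _)))
  refine ⟨margOp e, gates_marg e, ?_⟩
  intro ρ st hρ
  have e1 : ∀ i : Fin n, e (Fin.castAdd w (Fin.cast hc.symm (Fin.castAdd (s * n) i)))
      = Sum.inl (Fin.castAdd w i) := by
    intro i
    simp [e]
  have e2 : ∀ i : Fin (s * n), e (Fin.castAdd w (Fin.cast hc.symm (Fin.natAdd n i)))
      = Sum.inr i := by
    intro i
    simp [e]
  have e3 : ∀ i : Fin w, e (Fin.natAdd ((s + 1) * n) i) = Sum.inl (Fin.natAdd n i) := by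
    intro i
    simp [e]
  ext x y
  simp only [margOp, Matrix.of_apply, tensorOp_apply, itTensor, castOp_apply, e1, e2, e3,
    Sum.elim_inl, Sum.elim_inr]
  rw [← Finset.sum_mul, ← Finset.mul_sum]
  have := trace_itTensor s ρ hρ
  simp only [Matrix.trace, Matrix.diag] at this
  rw [this, mul_one]

theorem gates_keyDiscard (d : ℕ) :
    Gates (clControlled (a := d) (b := 1) (c := 1) (fun _ => id)) (1 + d) := by
  have : clControlled (a := d) (b := 1) (c := 1) (fun _ => id)
      = margOp (finSumFinEquiv.symm.trans (Equiv.sumComm (Fin d) (Fin 1))) := by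
    funext M
    ext x y
    simp only [clControlled, margOp, Matrix.of_apply, id, Matrix.sum_apply, Matrix.reindex_apply,
      Matrix.submatrix_apply]
    refine Finset.sum_congr rfl fun u _ => ?_
    have h : ∀ z : BString 1, (bsplit d 1).symm (u, z) = fun i =>
        Sum.elim z u ((finSumFinEquiv.symm.trans (Equiv.sumComm (Fin d) (Fin 1))) i) := by
      intro z
      funext i
      induction i using Fin.addCases with
      | left i => simp [bsplit_symm_castAdd]
      | right i => simp [bsplit_symm_natAdd]
    rw [h, h]
  rw [this]
  exact gates_marg _

theorem extendR_id (a m : ℕ) : extendR (id : QOp a → QOp a) m = id := by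
  funext M
  ext x y
  simp [extendR]

theorem extendL_id (a m : ℕ) : extendL m (id : QOp a → QOp a) = id := by
  funext M
  ext x y
  simp [extendL]

theorem itTensorMap_id (a t : ℕ) (M : QOp (t * a)) :
    itTensorMap t (fun _ => (id : QOp a → QOp a)) M = M := by
  induction t with
  | zero => rfl
  | succ t ih =>
    have h : itTensorMap t (fun _ => (id : QOp a → QOp a)) = id := funext ih
    simp only [itTensorMap, tensorMap, h, extendR_id, extendL_id, id]
    rfl

/-- Measure the first of two qubits, and overwrite the second by the outcome. -/
def copyCh : QOp 2 → QOp 2 := clChannel (fun s => basisOp (fun _ => s 0))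

theorem copyCh_channel : IsChannel copyCh where
  linear := by
    constructor
    · intro M N
      simp [copyCh, clChannel, add_smul, Finset.sum_add_distrib]
    · intro c M
      simp [copyCh, clChannel, mul_smul, Finset.smul_sum]
  cp := by
    intro m ρ hρ
    let D : BString 2 → QOp (2 + m) := fun s =>
      Matrix.diagonal fun p => if (bsplit 2 m p).1 = (fun _ => s 0) then 1 else 0
    have key : extendR copyCh m ρ = ∑ s : BString 2,
        D s * (ρ.submatrix (fun p => (bsplit 2 m).symm (s, (bsplit 2 m p).2))
          (fun p => (bsplit 2 m).symm (s, (bsplit 2 m p).2))) * (D s)ᴴ := by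
      ext x y
      simp only [extendR, copyCh, clChannel, Matrix.reindex_apply, Matrix.submatrix_apply,
        Matrix.of_apply, Matrix.sum_apply, Equiv.symm_symm, Matrix.smul_apply, basisOp, D,
        Matrix.diagonal_conjTranspose, Matrix.mul_diagonal, Matrix.diagonal_mul]
      refine Finset.sum_congr rfl fun s _ => ?_
      by_cases h1 : (bsplit 2 m x).1 = (fun _ => s 0) <;>
      by_cases h2 : (bsplit 2 m y).1 = (fun _ => s 0) <;> simp [h1, h2]
    rw [key]
    exact Matrix.posSemidef_sum _ fun s _ => (hρ.submatrix _).mul_mul_conjTranspose_same _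
  tp := by
    intro ρ
    simp only [copyCh, clChannel, Matrix.trace_sum, Matrix.trace_smul]
    refine Finset.sum_congr rfl fun s _ => ?_
    simp [Matrix.trace, basisOp]

theorem extendR_copyCh_const (n : ℕ) (N : QOp (2 + n)) (b : Bool) :
    extendR copyCh n N (fun _ => b) (fun _ => b) =
      ∑ s : BString 2, if s 0 = b then
        N ((bsplit 2 n).symm (s, fun _ => b)) ((bsplit 2 n).symm (s, fun _ => b)) else 0 := by
  simp only [extendR, copyCh, clChannel, Matrix.reindex_apply, Matrix.submatrix_apply,
    Matrix.of_apply, Matrix.sum_apply, Equiv.symm_symm, Matrix.smul_apply, basisOp,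
    bsplit_apply']
  refine Finset.sum_congr rfl fun s _ => ?_
  by_cases h : s 0 = b
  · simp [h]
  · have : ¬ ((fun _ : Fin 2 => b) = fun _ => s 0) := fun h' => h (congrFun h' 0).symm
    simp [h, this]

theorem exists_broadcast_aux (n : ℕ) :
    ∃ B : QOp 1 → QOp (n + 1), Gates B (4 * n) ∧
      ∀ M (b : Bool), B M (fun _ => b) (fun _ => b) = M (fun _ => b) (fun _ => b) := by
  induction n with
  | zero => exact ⟨id, Gates.id 1, fun _ _ => rfl⟩
  | succ n ih =>
    obtain ⟨B, hB, hB'⟩ := ih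
    have h2 : n + 1 + 1 = 2 + n := by ring
    -- swap the ancilla (last wire) into position one
    let e0 : Fin (n + 1 + 1) ≃ Fin (2 + n) :=
      (finCongr h2).trans (Equiv.swap (Fin.cast h2 (Fin.natAdd (n + 1) (0 : Fin 1)))
        (Fin.castAdd n 1))
    refine ⟨rewireOp (finCongr h2.symm) ∘ (extendR copyCh n ∘ (rewireOp e0 ∘ (addAncilla ∘ B))),
      ?_, ?_⟩
    · have : 4 * (n + 1) = 4 * n + 1 + 1 + 1 + 1 := by ring
      rw [this]
      exact (((hB.comp (Gates.ancilla _)).comp (gates_rewire _)).comp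
        (Gates.gate _ copyCh_channel)).comp (gates_rewire _)
    · intro M b
      rw [← hB' M b]
      change extendR copyCh n (rewireOp e0 (addAncilla (B M))) (fun _ => b) (fun _ => b) = _
      rw [extendR_copyCh_const]
      have hlast : ∀ s : BString 2, (bsplit 2 n).symm (s, fun _ => b)
          (e0 (Fin.natAdd (n + 1) (0 : Fin 1))) = s 1 := by
        intro s
        simp only [e0, Equiv.trans_apply, finCongr_apply, Equiv.swap_apply_left]
        rw [bsplit_symm_castAdd]
      have hother : ∀ (s : BString 2), s 0 = b → ∀ i : Fin (n + 1),
          (bsplit 2 n).symm (s, fun _ => b) (e0 (Fin.castAdd 1 i)) = b := by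
        intro s hs i
        have hne : e0 (Fin.castAdd 1 i) ≠ Fin.castAdd n 1 := by
          intro h
          have h' : e0 (Fin.natAdd (n + 1) (0 : Fin 1)) = Fin.castAdd n 1 := by
            simp [e0, -Fin.natAdd_eq_addNat]
          have := congrArg Fin.val (e0.injective (h.trans h'.symm))
          simp at this
          omega
        revert hne
        generalize e0 (Fin.castAdd 1 i) = j
        intro hne
        induction j using Fin.addCases with
        | left j =>
          rw [bsplit_symm_castAdd]
          fin_cases j
          · exact hs
          · exact absurd rfl hne
        | right j => rw [bsplit_symm_natAdd]
      have hterm : ∀ s : BString 2, (if s 0 = b then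
          rewireOp e0 (addAncilla (B M)) ((bsplit 2 n).symm (s, fun _ => b))
            ((bsplit 2 n).symm (s, fun _ => b)) else 0) =
          if s = ![b, false] then B M (fun _ => b) (fun _ => b) else 0 := by
        intro s
        have hs_iff : s = ![b, false] ↔ s 0 = b ∧ s 1 = false := by
          constructor
          · rintro rfl; simp
          · rintro ⟨h0, h1⟩
            funext i
            fin_cases i
            · exact h0
            · exact h1
        by_cases h0 : s 0 = b
        · have hfun : ∀ i : Fin 1, (bsplit 2 n).symm (s, fun _ => b)
              (e0 (Fin.natAdd (n + 1) i)) = s 1 := by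
            intro i
            rw [Subsingleton.elim i 0]
            exact hlast s
          simp only [h0, if_true, rewireOp, Matrix.of_apply, addAncilla, tensorOp_apply,
            hother s h0, hfun, basisOp, hs_iff, true_and]
          have : ((fun _ : Fin 1 => s 1) = bzero 1) ↔ s 1 = false :=
            ⟨fun h => congrFun h 0, fun h => by funext i; simp [bzero, h]⟩
          simp [this]
        · simp [hs_iff, h0]
      rw [Finset.sum_congr rfl fun s _ => hterm s]
      simp

theorem exists_broadcast (n : ℕ) (hn : 1 ≤ n) :
    ∃ B : QOp 1 → QOp (n * 1), Gates B (4 * n) ∧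
      ∀ M (b : Bool), B M (fun _ => b) (fun _ => b) = M (fun _ => b) (fun _ => b) := by
  obtain ⟨s, rfl⟩ : ∃ s, n = s + 1 := ⟨n - 1, by omega⟩
  obtain ⟨B, hB, hB'⟩ := exists_broadcast_aux s
  rw [mul_one]
  -- pad the circuit with four trivial permutations
  refine ⟨permOp 1 ∘ (permOp 1 ∘ (permOp 1 ∘ (permOp 1 ∘ B))), ?_, hB'⟩
  exact (((hB.comp (Gates.perm 1)).comp (Gates.perm 1)).comp (Gates.perm 1)).comp (Gates.perm 1)

theorem gates_width {a b : ℕ} {F : QOp a → QOp b} {k : ℕ} (h : Gates F k) : b ≤ a + k := by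
  induction h with
  | id a => simp
  | comp _ _ ih1 ih2 => omega
  | perm => omega
  | gate => omega
  | ancilla => omega
  | discard => omega

theorem ogates_width {oi oo d : ℕ} (hd : oo ≤ oi + d) {a b : ℕ}
    {F : (QOp oi → QOp oo) → QOp a → QOp b} {k : ℕ} (h : OGates oi oo F k) :
    b ≤ a + k * (1 + d) := by
  induction h with
  | plain h =>
    have := gates_width h
    nlinarith [Nat.zero_le (k * d)]
  | call m => omega
  | comp _ _ ih1 ih2 => rw [add_mul]; omega

theorem clone_to_ind (t t' : Polynomial ℕ) (h1 : ∀ l, 1 ≤ t.eval l)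
    (ht : ∀ l, t.eval l < t'.eval l) (S : EncScheme)
    (hS : ReusableCloneSecure S (fun l => t.eval l) (fun l => t'.eval l)) : IndCpaSecure S := by
  intro A
  choose D hD hD' using fun l => exists_discard (t.eval l) (S.ℓct l) (A.w l) (h1 l)
  choose B hB hB' using fun l => exists_broadcast (t'.eval l)
    (le_trans (h1 l) (ht l).le)
  obtain ⟨pg, hpg⟩ := S.gen_poly
  obtain ⟨pe, hpe⟩ := S.enc_poly
  obtain ⟨p1, hp1⟩ := A.C1_poly
  obtain ⟨p2, hp2⟩ := A.C2_poly
  have hkey : ∀ l, S.ℓek l + S.ℓdk l ≤ pg.eval l := by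
    intro l
    obtain ⟨k, hk, hg⟩ := hpg l
    have : S.ℓek l + S.ℓdk l ≤ 0 + k := gates_width hg
    omega
  have hct : ∀ l, S.ℓct l ≤ S.ℓm l + (pg + pe).eval l := by
    intro l
    obtain ⟨k, hk, hg⟩ := hpe l
    have : S.ℓct l ≤ S.ℓek l + S.ℓm l + k := gates_width hg
    have := hkey l
    rw [Polynomial.eval_add]
    omega
  have hm : ∀ l, S.ℓm l ≤ (p1 * (1 + (pg + pe))).eval l := by
    intro l
    obtain ⟨k, hk, hg⟩ := hp1 l
    have h : S.ℓm l + S.ℓm l + A.w l ≤ 0 + k * (1 + (pg + pe).eval l) :=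
      ogates_width (hct l) hg
    have h' := Nat.mul_le_mul_right (1 + (pg + pe).eval l) hk
    rw [Polynomial.eval_mul, Polynomial.eval_add, Polynomial.eval_one]
    omega
  let A' : CloneAdv S (fun l => t.eval l) (fun l => t'.eval l) :=
    { w := A.w
      wA := fun _ => 1
      C1 := A.C1
      C2 := fun l O => B l ∘ (A.C2 l O ∘ D l)
      A := fun l i _ => id
      C1_poly := A.C1_poly
      C2_poly := by
        refine ⟨(1 + t * (p1 * (1 + (pg + pe)) + (pg + pe))) + p2 + 4 * t', fun l => ?_⟩
        obtain ⟨k, hk, hg⟩ := hp2 l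
        refine ⟨_, ?_, ((OGates.plain (hD l)).comp hg).comp (OGates.plain (hB l))⟩
        have ha : (t.eval l - 1) * S.ℓct l ≤
            t.eval l * ((p1 * (1 + (pg + pe))).eval l + (pg + pe).eval l) :=
          Nat.mul_le_mul (Nat.sub_le _ _) ((hct l).trans (Nat.add_le_add_right (hm l) _))
        have h4 : (4 * t').eval l = 4 * t'.eval l := by
          rw [Polynomial.eval_mul]; simp
        rw [Polynomial.eval_add, Polynomial.eval_add, Polynomial.eval_add, h4,
          Polynomial.eval_mul (p := t), Polynomial.eval_add (p := p1 * (1 + (pg + pe))),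
          Polynomial.eval_one]
        omega
      A_poly := by
        refine ⟨1 + pg, fun l i => ⟨_, ?_, gates_keyDiscard _⟩⟩
        have := hkey l
        rw [Polynomial.eval_add, Polynomial.eval_one]
        omega }
  obtain ⟨ε, hε, hwin⟩ := hS A'
  refine ⟨ε, hε, fun l => ?_⟩
  refine le_of_eq_of_le ?_ (hwin l)
  simp only [indWin, cloneWin, A', itTensorMap_id, Function.comp, diagProb, hB']
  refine Finset.sum_congr rfl fun kd _ => ?_
  congr 2
  refine Finset.sum_congr rfl fun b _ => Finset.sum_congr rfl fun m _ => ?_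
  rw [hD' l _ _ (S.enc_density l _ _).2]

end Helpers

/- ================================================================
   STATEMENT 14.  Reusable `t → t'` uncloneable security implies
   reusable IND-CPA security; consequently the existence of reusable
   uncloneable encryption implies the existence of reusable IND-CPA
   symmetric key encryption.
   ================================================================ -/

theorem reusable_uncloneable_implies_reusable_SKE
    (t t' : Polynomial ℕ) (h1 : ∀ l, 1 ≤ t.eval l) (ht : ∀ l, t.eval l < t'.eval l) :
    (∀ S : EncScheme, Correct S →
        ReusableCloneSecure S (fun l => t.eval l) (fun l => t'.eval l) → IndCpaSecure S) ∧
    ((∃ S : EncScheme, Correct S ∧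
        ReusableCloneSecure S (fun l => t.eval l) (fun l => t'.eval l)) →
      ∃ S : EncScheme, Correct S ∧ IndCpaSecure S) := by
  have key : ∀ S : EncScheme, Correct S →
      ReusableCloneSecure S (fun l => t.eval l) (fun l => t'.eval l) → IndCpaSecure S :=
    fun S _ h => clone_to_ind t t' h1 ht S h
  exact ⟨key, fun ⟨S, hc, h⟩ => ⟨S, hc, key S hc h⟩⟩
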